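/- Let p be a prime, m ≥ 0 and n ≥ 1 integers, and let μ be the Haar probability measure on the compact additive group Mat_{n×(n+m)}(ℤ_p) of n×(n+m) matrices over the p-adic integers. Let G be a finite abelian p-group with r := dim_{F_p}(G/pG) ≤ n. Then μ({M : coker M ≅ G}) = |G|^{−m} · |Aut(G)|^{−1} · η_{n+m}(p) · η_n(p) / (η_m(p) · η_{n−r}(p)). -/

import Mathlib

noncomputable section

open MeasureTheory

/-- `η_k(q) = ∏_{i=1}^{k} (1 - q^{-i})`. -/
def etaF (q : ℝ) (k : ℕ) : ℝ := ∏ i ∈ Finset.range k, (1 - q⁻¹ ^ (i + 1))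

instance matMeasurableSpace (p a b : ℕ) [Fact p.Prime] :
    MeasurableSpace (Matrix (Fin a) (Fin b) ℤ_[p]) := borel _

instance matBorelSpace (p a b : ℕ) [Fact p.Prime] :
    BorelSpace (Matrix (Fin a) (Fin b) ℤ_[p]) := ⟨rfl⟩

open Module IsLocalRing

theorem linearIndependent_iff_span_transpose_eq_top {K : Type*} [Field K] {r k : ℕ}
    (v : Fin r → Fin k → K) :
    LinearIndependent K v ↔ Submodule.span K (Set.range fun j i => v i j) = ⊤ := by
  rw [linearIndependent_iff_card_eq_finrank_span, Set.finrank]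
  have h1 := (Matrix.of v).rank_eq_finrank_span_row
  have h2 := (Matrix.of v).rank_eq_finrank_span_cols
  change _ = finrank K (Submodule.span K (Set.range v)) at h1
  change _ = finrank K (Submodule.span K (Set.range fun j i => v i j)) at h2
  rw [← h1, h2]
  constructor
  · intro h
    apply Submodule.eq_top_of_finrank_eq
    rw [← h]; simp
  · intro h
    rw [h]; simp

theorem card_span_eq_top {K V : Type*} [Field K] [Finite K] [AddCommGroup V] [Module K V]
    [Module.Finite K V] {k : ℕ} (hk : finrank K V ≤ k) :
    Nat.card {t : Fin k → V // Submodule.span K (Set.range t) = ⊤} =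
      ∏ i : Fin (finrank K V), (Nat.card K ^ k - Nat.card K ^ i.val) := by
  have := Fintype.ofFinite K
  have h := card_linearIndependent (K := K) (V := Fin k → K) (k := finrank K V) (by simpa using hk)
  rw [Module.finrank_fin_fun, ← Nat.card_eq_fintype_card] at h
  rw [← h]
  let e : V ≃ₗ[K] (Fin (finrank K V) → K) := (finBasis K V).equivFun
  refine Nat.card_congr ?_
  refine Equiv.subtypeEquiv ((Equiv.arrowCongr (Equiv.refl _) e.toEquiv).trans
    (Equiv.piComm fun _ _ => K)) fun t => ?_
  rw [linearIndependent_iff_span_transpose_eq_top]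
  change _ ↔ Submodule.span K (Set.range (e ∘ t)) = ⊤
  rw [Set.range_comp, ← LinearEquiv.coe_coe, Submodule.span_image,
    Submodule.map_eq_top_iff]

theorem etaF_pos {q : ℝ} (hq : 1 < q) (k : ℕ) : 0 < etaF q k :=
  Finset.prod_pos fun i _ => sub_pos.2 <| pow_lt_one₀ (by positivity) (inv_lt_one_of_one_lt₀ hq)
    i.succ_ne_zero

theorem etaF_add (q : ℝ) (a b : ℕ) :
    etaF q (a + b) = etaF q a * ∏ i ∈ Finset.range b, (1 - q⁻¹ ^ (a + i + 1)) := by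
  rw [etaF, etaF, Finset.prod_range_add]

theorem prod_pow_sub_pow {q : ℕ} (hq : 1 < q) {r k : ℕ} (hrk : r ≤ k) :
    ((∏ i : Fin r, (q ^ k - q ^ i.val) : ℕ) : ℝ) =
      (q : ℝ) ^ (r * k) * (etaF q k / etaF q (k - r)) := by
  have hq' : (1 : ℝ) < q := by exact_mod_cast hq
  obtain ⟨a, rfl⟩ := Nat.exists_eq_add_of_le' hrk
  rw [Nat.add_sub_cancel, etaF_add, mul_div_cancel_left₀ _ (etaF_pos hq' a).ne', pow_mul',
    Fin.prod_univ_eq_prod_range fun i => q ^ (a + r) - q ^ i, ← Finset.prod_range_reflect,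
    Nat.cast_prod]
  conv_rhs => rw [← Finset.card_range r, ← Finset.prod_const, Finset.card_range]
  rw [← Finset.prod_mul_distrib]
  refine Finset.prod_congr rfl fun i hi => ?_
  have hi := Finset.mem_range.1 hi
  have h : a + r = (r - 1 - i) + (a + i + 1) := by omega
  rw [Nat.cast_sub (Nat.pow_le_pow_right hq.le (by omega)), mul_sub, mul_one, Nat.cast_pow,
    Nat.cast_pow, h, pow_add _ _ (a + i + 1), mul_assoc, ← mul_pow, mul_inv_cancel₀ (by positivity),
    one_pow, mul_one]

theorem card_preimage_addMonoidHom {A B : Type*} [AddGroup A] [AddGroup B]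
    (f : A →+ B) (hf : Function.Surjective f) (S : Set B) :
    Nat.card (f ⁻¹' S) = Nat.card f.ker * Nat.card S := by
  let g := Function.surjInv hf
  have hg : ∀ b, f (g b) = b := Function.surjInv_eq hf
  rw [← Nat.card_prod]
  refine (Nat.card_congr
    { toFun := fun x => ⟨g x.2 + x.1, ?_⟩
      invFun := fun a => (⟨-g (f a) + a, ?_⟩, ⟨f a, a.2⟩)
      left_inv := ?_
      right_inv := ?_ }).symm
  rotate_left 2
  · rw [Set.mem_preimage, map_add, hg, f.mem_ker.1 x.1.2, add_zero]
    exact x.2.2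
  · simp [AddMonoidHom.mem_ker, hg]
  · rintro ⟨⟨x, hx⟩, b⟩
    ext <;> simp [hg, f.mem_ker.1 hx]
  · intro a
    ext
    simp

theorem card_span_eq_top_of_isLocalRing {R G : Type*} [CommRing R] [IsLocalRing R]
    [Finite (ResidueField R)] [AddCommGroup G] [Module R G] [Finite G] {r k : ℕ}
    (hr : Nat.card (G ⧸ (maximalIdeal R • ⊤ : Submodule R G)) = Nat.card (ResidueField R) ^ r)
    (hrk : r ≤ k) :
    (Nat.card {t : Fin k → G // Submodule.span R (Set.range t) = ⊤} : ℝ) =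
      (Nat.card G : ℝ) ^ k *
        (etaF (Nat.card (ResidueField R)) k / etaF (Nat.card (ResidueField R)) (k - r)) := by
  set q := Nat.card (ResidueField R) with hq
  have hq1 : 1 < q := Finite.one_lt_card
  let : Module (ResidueField R) (G ⧸ (maximalIdeal R • ⊤ : Submodule R G)) :=
    (inferInstance : Module (R ⧸ maximalIdeal R) (G ⧸ (maximalIdeal R • ⊤ : Submodule R G)))
  have : IsScalarTower R (ResidueField R) (G ⧸ (maximalIdeal R • ⊤ : Submodule R G)) :=
    (inferInstance : IsScalarTower R (R ⧸ maximalIdeal R)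
      (G ⧸ (maximalIdeal R • ⊤ : Submodule R G)))
  let f : G →ₗ[R] (G ⧸ (maximalIdeal R • ⊤ : Submodule R G)) := Submodule.mkQ _
  have hf : Function.Surjective f := Submodule.mkQ_surjective _
  have key : ∀ t : Fin k → G, Submodule.span R (Set.range t) = ⊤ ↔
      Submodule.span (ResidueField R) (Set.range (f ∘ t)) = ⊤ := by
    intro t
    rw [← IsLocalRing.map_mkQ_eq_top, Submodule.map_span, ← Set.range_comp,
      ← Submodule.restrictScalars_eq_top_iff R (ResidueField R) _, Submodule.restrictScalars_span R
        (ResidueField R) (by exact residue_surjective)]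
  have : Module.Finite (ResidueField R) (G ⧸ (maximalIdeal R • ⊤ : Submodule R G)) :=
    Module.Finite.of_restrictScalars_finite R _ _
  have hV : finrank (ResidueField R) (G ⧸ (maximalIdeal R • ⊤ : Submodule R G)) = r := by
    have h := Module.natCard_eq_pow_finrank (K := ResidueField R)
      (V := G ⧸ (maximalIdeal R • ⊤ : Submodule R G))
    rw [hr] at h
    exact (Nat.pow_right_injective hq1 h).symm
  have : Finite (G ⧸ (maximalIdeal R • ⊤ : Submodule R G)) := Finite.of_surjective f hf
  let F : (Fin k → G) →+ (Fin k → (G ⧸ (maximalIdeal R • ⊤ : Submodule R G))) :=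
    f.toAddMonoidHom.compLeft (Fin k)
  have hF : Function.Surjective F := hf.comp_left
  have h1 := card_preimage_addMonoidHom F hF
    {t | Submodule.span (ResidueField R) (Set.range t) = ⊤}
  have h2 := card_preimage_addMonoidHom F hF Set.univ
  have h3 := card_span_eq_top (K := ResidueField R)
    (V := G ⧸ (maximalIdeal R • ⊤ : Submodule R G)) (k := k) (hV.trans_le hrk)
  have h4 : Nat.card {t : Fin k → G // Submodule.span R (Set.range t) = ⊤} =
      Nat.card (F ⁻¹' {t | Submodule.span (ResidueField R) (Set.range t) = ⊤}) :=
    Nat.card_congr (Equiv.subtypeEquivRight key)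
  rw [Set.preimage_univ, Nat.card_univ, Nat.card_univ, Nat.card_fun, Nat.card_fun, hr,
    Nat.card_fin] at h2
  have h5 := prod_pow_sub_pow hq1 hrk
  rw [hV] at h3
  rw [h4, h1, Set.coe_ofPred, h3, Nat.cast_mul, h5, ← mul_assoc]
  congr 1
  exact_mod_cast (h2.trans (by rw [pow_mul])).symm

theorem card_submodule_mul_card_aut {R M G : Type*} [Ring R] [AddCommGroup M] [Module R M]
    [AddCommGroup G] [Module R G] :
    Nat.card {L : Submodule R M // Nonempty ((M ⧸ L) ≃ₗ[R] G)} * Nat.card (G ≃ₗ[R] G) =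
      Nat.card {f : M →ₗ[R] G // Function.Surjective f} := by
  rw [← Nat.card_prod]
  let F : {L : Submodule R M // Nonempty ((M ⧸ L) ≃ₗ[R] G)} × (G ≃ₗ[R] G) →
      {f : M →ₗ[R] G // Function.Surjective f} := fun x =>
    ⟨(x.1.2.some.trans x.2).toLinearMap ∘ₗ x.1.1.mkQ,
      (x.1.2.some.trans x.2).surjective.comp x.1.1.mkQ_surjective⟩
  have hker : ∀ x, LinearMap.ker (F x).1 = x.1.1 := fun x => by
    simp only [F]
    rw [LinearEquiv.ker_comp, Submodule.ker_mkQ]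
  refine Nat.card_eq_of_bijective F ⟨?_, ?_⟩
  · rintro ⟨L, a⟩ ⟨L', a'⟩ h
    obtain rfl : L = L' := Subtype.ext (by rw [← hker ⟨L, a⟩, h, hker])
    have h' : ∀ x, a (L.2.some (L.1.mkQ x)) = a' (L.2.some (L.1.mkQ x)) :=
      fun x => LinearMap.congr_fun (congrArg Subtype.val h) x
    have : a = a' := by
      ext g
      obtain ⟨x, hx⟩ := L.1.mkQ_surjective (L.2.some.symm g)
      simpa [hx] using h' x
    rw [this]
  · rintro ⟨f, hf⟩
    let L : {L : Submodule R M // Nonempty ((M ⧸ L) ≃ₗ[R] G)} :=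
      ⟨LinearMap.ker f, ⟨f.quotKerEquivOfSurjective hf⟩⟩
    refine ⟨⟨L, L.2.some.symm.trans (f.quotKerEquivOfSurjective hf)⟩, ?_⟩
    ext x
    simp only [F, LinearMap.comp_apply, LinearEquiv.coe_coe, LinearEquiv.trans_apply,
      LinearEquiv.symm_apply_apply]
    rfl

theorem card_surjective_linearMap {R G ι : Type*} [CommRing R] [AddCommGroup G] [Module R G]
    [Finite ι] :
    Nat.card {f : (ι → R) →ₗ[R] G // Function.Surjective f} =
      Nat.card {t : ι → G // Submodule.span R (Set.range t) = ⊤} := by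
  refine Nat.card_congr (Equiv.subtypeEquiv ((Pi.basisFun R ι).constr R).symm.toEquiv fun f => ?_)
  rw [← LinearMap.range_eq_top, ← (Pi.basisFun R ι).constr_range R,
    ← ((Pi.basisFun R ι).constr R).apply_symm_apply f]
  simp

theorem card_quotient_maximalIdeal_smul_top {R L : Type*} [CommRing R] [IsLocalRing R]
    [AddCommGroup L] [Module R L] [Module.Free R L] [Module.Finite R L] :
    Nat.card (L ⧸ (maximalIdeal R • ⊤ : Submodule R L)) =
      Nat.card (ResidueField R) ^ finrank R L := by
  rw [← Module.finrank_baseChange (R := ResidueField R), ← Module.natCard_eq_pow_finrank]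
  exact Nat.card_congr (TensorProduct.quotTensorEquivQuotSMul L (maximalIdeal R)).symm.toEquiv

theorem finrank_eq_of_finite_quotient {R M : Type*} [CommRing R] [IsDomain R] [CharZero R]
    [AddCommGroup M] [Module R M] [Module.Finite R M] (L : Submodule R M) [Finite (M ⧸ L)] :
    finrank R L = finrank R M := by
  rw [← L.finrank_quotient_add_finrank]
  have : finrank R (M ⧸ L) = 0 := by
    rw [Module.finrank_eq_zero_iff_isTorsion]
    exact fun x => ⟨⟨(Nat.card (M ⧸ L) : R), mem_nonZeroDivisors_of_ne_zero <|
      Nat.cast_ne_zero.2 Nat.card_pos.ne'⟩, by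
        rw [Submonoid.mk_smul, Nat.cast_smul_eq_nsmul, card_nsmul_eq_zero']⟩
  omega

theorem card_span_eq_submodule {R M ι : Type*} [Ring R] [AddCommGroup M] [Module R M]
    (L : Submodule R M) :
    Nat.card {t : ι → M // Submodule.span R (Set.range t) = L} =
      Nat.card {t : ι → L // Submodule.span R (Set.range t) = ⊤} := by
  have h : ∀ t : ι → L, Submodule.span R (Set.range t) = ⊤ ↔
      Submodule.span R (Set.range fun i => (t i : M)) = L := fun t => by
    rw [← (Submodule.map_injective_of_injective L.subtype_injective).eq_iff, Submodule.map_span,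
      ← Set.range_comp, Submodule.map_top, Submodule.range_subtype]
    rfl
  exact Nat.card_congr
    { toFun := fun t => ⟨fun i => ⟨t.1 i, t.2.le (Submodule.subset_span ⟨i, rfl⟩)⟩, (h _).2 t.2⟩
      invFun := fun t => ⟨fun i => t.1 i, (h _).1 t.2⟩
      left_inv := fun _ => rfl
      right_inv := fun _ => rfl }

section Nakayama

variable {R M : Type*} [CommRing R] [IsLocalRing R] [AddCommGroup M] [Module R M]
  (L : Submodule R M)

theorem eq_iff_map_mkQ_maximalIdeal_smul_eq (hL : L.FG) (N : Submodule R M) :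
    N = L ↔ N.map (maximalIdeal R • L).mkQ = L.map (maximalIdeal R • L).mkQ := by
  refine ⟨fun h => h ▸ rfl, fun h => ?_⟩
  have hle : N ≤ L := by
    have := Submodule.map_le_iff_le_comap.1 h.le
    rwa [Submodule.comap_map_mkQ, sup_eq_right.2 Submodule.smul_le_right] at this
  exact (IsLocalRing.map_mkQ_eq hle hL).1 h

theorem card_map_mkQ_maximalIdeal_smul [Module.Free R L] [Module.Finite R L] :
    Nat.card (L.map (maximalIdeal R • L).mkQ) = Nat.card (ResidueField R) ^ finrank R L := by
  rw [← card_quotient_maximalIdeal_smul_top]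
  let g : L →ₗ[R] M ⧸ maximalIdeal R • L := (maximalIdeal R • L).mkQ ∘ₗ L.subtype
  have hr : LinearMap.range g = L.map (maximalIdeal R • L).mkQ := by
    rw [LinearMap.range_comp, Submodule.range_subtype]
  have hk : LinearMap.ker g = maximalIdeal R • ⊤ := by
    rw [LinearMap.ker_comp, Submodule.ker_mkQ]
    apply Submodule.map_injective_of_injective L.subtype_injective
    rw [Submodule.map_comap_subtype, inf_eq_right.2 Submodule.smul_le_right, Submodule.map_smul'',
      Submodule.map_top, Submodule.range_subtype]
  rw [← hr, ← hk]
  exact (Nat.card_congr g.quotKerEquivRange.toEquiv).symm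

theorem maximalIdeal_smul_top_map_mkQ :
    (maximalIdeal R • ⊤ : Submodule R (L.map (maximalIdeal R • L).mkQ)) = ⊥ := by
  apply Submodule.map_injective_of_injective (Submodule.subtype_injective _)
  rw [Submodule.map_smul'', Submodule.map_top, Submodule.range_subtype, ← Submodule.map_smul'',
    Submodule.map_bot, Submodule.mkQ_map_self]

theorem card_quotient_maximalIdeal_smul [Module.Free R L] [Module.Finite R L] :
    Nat.card (M ⧸ maximalIdeal R • L) =
      Nat.card (ResidueField R) ^ finrank R L * Nat.card (M ⧸ L) := by
  rw [(L.map (maximalIdeal R • L).mkQ).card_eq_card_quotient_mul_card,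
    card_map_mkQ_maximalIdeal_smul]
  congr 1
  exact Nat.card_congr
    (Submodule.quotientQuotientEquivQuotient _ _ Submodule.smul_le_right).toEquiv

/-- The proportion of tuples in `M ⧸ 𝔪 L` which generate the image of `L`. -/
theorem card_span_eq_map_mkQ [Finite (ResidueField R)] [Module.Free R L] [Module.Finite R L]
    [Finite (M ⧸ L)] {k : ℕ} (hk : finrank R L ≤ k) :
    (Nat.card {t : Fin k → M ⧸ maximalIdeal R • L //
        Submodule.span R (Set.range t) = L.map (maximalIdeal R • L).mkQ} : ℝ) /
      Nat.card (Fin k → M ⧸ maximalIdeal R • L) = (Nat.card (M ⧸ L) : ℝ)⁻¹ ^ k *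
        (etaF (Nat.card (ResidueField R)) k /
          etaF (Nat.card (ResidueField R)) (k - finrank R L)) := by
  have hq : 0 < Nat.card (ResidueField R) := Nat.card_pos
  have hL : 0 < Nat.card (M ⧸ L) := Nat.card_pos
  have hcard := card_map_mkQ_maximalIdeal_smul L
  have : Finite (L.map (maximalIdeal R • L).mkQ) :=
    Nat.finite_of_card_ne_zero (by rw [hcard]; positivity)
  rw [card_span_eq_submodule, card_span_eq_top_of_isLocalRing _ hk, Nat.card_fun,
    card_quotient_maximalIdeal_smul, hcard, Nat.card_fin]
  · push_cast
    rw [mul_pow, inv_pow]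
    field_simp
  · rw [← hcard]
    exact Nat.card_congr (Submodule.quotEquivOfEqBot _ (maximalIdeal_smul_top_map_mkQ L)).toEquiv

end Nakayama

theorem measureReal_preimage_addMonoidHom {X A : Type*} [AddGroup X] [MeasurableSpace X]
    [MeasurableAdd X] (μ : Measure X) [μ.IsAddLeftInvariant]
    [IsProbabilityMeasure μ] [AddGroup A] [Finite A]
    (f : X →+ A) (hf : Function.Surjective f) (hm : ∀ a, MeasurableSet (f ⁻¹' {a})) (S : Set A) :
    μ.real (f ⁻¹' S) = (Nat.card S : ℝ) / Nat.card A := by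
  have hfib : ∀ a, μ.real (f ⁻¹' {a}) = μ.real (f ⁻¹' {0}) := fun a => by
    obtain ⟨x, rfl⟩ := hf a
    have h : f ⁻¹' {f x} = (fun y => -x + y) ⁻¹' (f ⁻¹' {0}) := by
      ext y
      simp [neg_add_eq_zero, eq_comm (b := f x)]
    rw [h, Measure.real, measure_preimage_add, Measure.real]
  have hsum : ∀ T : Set A, μ.real (f ⁻¹' T) = Nat.card T * μ.real (f ⁻¹' {0}) := fun T => by
    have hT := T.toFinite
    have h : f ⁻¹' T = ⋃ a ∈ hT.toFinset, f ⁻¹' {a} := by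
      ext y
      simp
    rw [h, measureReal_biUnion_finset]
    · rw [Finset.sum_congr rfl fun a _ => hfib a, Finset.sum_const, nsmul_eq_mul,
        Nat.card_eq_card_finite_toFinset hT]
    · intro a _ b _ hab
      exact Disjoint.preimage f (by simpa using hab)
    · exact fun a _ => hm a
  have h1 := hsum Set.univ
  rw [Set.preimage_univ, probReal_univ, Nat.card_univ] at h1
  rw [hsum S, eq_div_iff (by intro h; simp [h] at h1), mul_assoc, mul_comm (μ.real _), ← h1,
    mul_one]

theorem PadicInt.setOf_natCast_dvd_mem_nhds_zero {p : ℕ} [Fact p.Prime] {N : ℕ} (hN : N ≠ 0) :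
    {x : ℤ_[p] | (N : ℤ_[p]) ∣ x} ∈ nhds 0 := by
  have hN' : (N : ℤ_[p]) ≠ 0 := Nat.cast_ne_zero.2 hN
  refine Filter.mem_of_superset (Metric.ball_mem_nhds 0 (norm_pos_iff.2 hN')) fun x hx => ?_
  rw [mem_ball_zero_iff, PadicInt.norm_eq_zpow_neg_valuation hN'] at hx
  rw [Set.mem_ofPred_eq, PadicInt.unitCoeff_spec hN', Units.mul_left_dvd,
    ← Ideal.mem_span_singleton]
  exact (PadicInt.norm_le_pow_iff_mem_span_pow _ _).1 hx.le

theorem isOpen_preimage_singleton_of_finite {p a b : ℕ} [Fact p.Prime] {A : Type*} [AddGroup A]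
    [Finite A] (f : Matrix (Fin a) (Fin b) ℤ_[p] →+ A) (x : A) : IsOpen (f ⁻¹' {x}) := by
  have hker : IsOpen (f.ker : Set (Matrix (Fin a) (Fin b) ℤ_[p])) := by
    apply AddSubgroup.isOpen_of_mem_nhds (g := 0)
    have hN : Nat.card A ≠ 0 := Nat.card_pos.ne'
    have h : ∀ i j, ∀ᶠ M : Matrix (Fin a) (Fin b) ℤ_[p] in nhds 0,
        (Nat.card A : ℤ_[p]) ∣ M i j := fun i j =>
      (continuous_id.matrix_elem i j).tendsto 0
        (PadicInt.setOf_natCast_dvd_mem_nhds_zero hN)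
    filter_upwards [Filter.eventually_all.2 fun i => Filter.eventually_all.2 (h i)] with M hM
    choose M' hM' using hM
    have : M = Nat.card A • Matrix.of M' := by
      ext i j
      simp [hM', Matrix.smul_apply]
    rw [SetLike.mem_coe, AddMonoidHom.mem_ker, this, map_nsmul, card_nsmul_eq_zero']
  by_cases hx : ∃ y, f y = x
  · obtain ⟨y, rfl⟩ := hx
    have h : f ⁻¹' {f y} = (fun z => -y + z) ⁻¹' f.ker := by
      ext z
      simp [AddMonoidHom.mem_ker, neg_add_eq_zero, eq_comm (b := f y)]
    rw [h]
    exact hker.preimage (continuous_const.add continuous_id)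
  · convert isOpen_empty
    ext y
    simpa using fun h => hx ⟨y, h⟩

section

variable {p : ℕ} [Fact p.Prime]

theorem PadicInt.card_residueField : Nat.card (ResidueField ℤ_[p]) = p := by
  rw [Nat.card_congr PadicInt.residueField.toEquiv, Nat.card_zmod]

theorem PadicInt.exists_natCast_add_natCast_mul {N : ℕ} (hN : N ≠ 0) (a : ℤ_[p]) :
    ∃ (c : ℕ) (y : ℤ_[p]), a = c + N * y := by
  have h : {x : ℤ_[p] | (N : ℤ_[p]) ∣ a - x} ∈ nhds a := by
    have : Filter.Tendsto (fun x => a - x) (nhds a) (nhds 0) := by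
      simpa using (continuous_const.sub continuous_id).tendsto a (f := fun x => a - x)
    exact this (PadicInt.setOf_natCast_dvd_mem_nhds_zero hN)
  obtain ⟨_, ⟨c, rfl⟩, y, hy⟩ := PadicInt.denseRange_natCast.inter_nhds_nonempty h
  exact ⟨c, y, by rw [← hy]; ring⟩

/-- Additive maps into finite `ℤ_[p]`-modules are automatically `ℤ_[p]`-linear. -/
theorem PadicInt.map_smul_of_finite {Q G : Type*} [AddCommGroup Q] [Module ℤ_[p] Q]
    [AddCommGroup G] [Module ℤ_[p] G] [Finite G] (f : Q →+ G) (a : ℤ_[p]) (x : Q) :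
    f (a • x) = a • f x := by
  obtain ⟨c, y, rfl⟩ := PadicInt.exists_natCast_add_natCast_mul (Nat.card_pos (α := G)).ne' a
  simp only [add_smul, mul_smul, Nat.cast_smul_eq_nsmul, map_add, map_nsmul, card_nsmul_eq_zero']

/-- Additive equivalences onto finite `ℤ_[p]`-modules are `ℤ_[p]`-linear equivalences. -/
def PadicInt.addEquivEquivLinearEquiv {Q G : Type*} [AddCommGroup Q] [Module ℤ_[p] Q]
    [AddCommGroup G] [Module ℤ_[p] G] [Finite G] : (Q ≃+ G) ≃ (Q ≃ₗ[ℤ_[p]] G) where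
  toFun e := { e with map_smul' := PadicInt.map_smul_of_finite e.toAddMonoidHom }
  invFun e := e.toAddEquiv
  left_inv _ := rfl
  right_inv _ := rfl

theorem PadicInt.nonempty_module {G : Type*} [AddCommGroup G] [Finite G]
    (hG : ∀ g : G, ∃ k : ℕ, p ^ k • g = 0) : Nonempty (Module ℤ_[p] G) := by
  choose k hk using hG
  have := Fintype.ofFinite G
  have h : ∀ g : G, p ^ (Finset.univ.sup k) • g = 0 := fun g => by
    obtain ⟨c, hc⟩ := pow_dvd_pow p (Finset.le_sup (f := k) (Finset.mem_univ g))
    rw [hc, mul_comm, mul_smul, hk, smul_zero]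
  let := AddCommGroup.zmodModule h
  exact ⟨Module.compHom G (PadicInt.toZModPow (Finset.univ.sup k))⟩

theorem PadicInt.card_quotient_maximalIdeal_smul_top (G : Type*) [AddCommGroup G]
    [Module ℤ_[p] G] : Nat.card (G ⧸ (maximalIdeal ℤ_[p] • ⊤ : Submodule ℤ_[p] G)) =
      Nat.card (G ⧸ (p • AddMonoidHom.id G).range) := by
  have h : (maximalIdeal ℤ_[p] • ⊤ : Submodule ℤ_[p] G).toAddSubgroup =
      (p • AddMonoidHom.id G).range := by
    ext g
    rw [PadicInt.maximalIdeal_eq_span_p, Submodule.mem_toAddSubgroup,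
      Submodule.ideal_span_singleton_smul, Submodule.mem_smul_pointwise_iff_exists]
    simp [Nat.cast_smul_eq_nsmul]
  rw [← h]
  rfl

theorem measureReal_range_mulVecLin_eq {n m : ℕ}
    (μ : Measure (Matrix (Fin n) (Fin (n + m)) ℤ_[p])) [μ.IsAddLeftInvariant]
    [IsProbabilityMeasure μ] (L : Submodule ℤ_[p] (Fin n → ℤ_[p]))
    [Finite ((Fin n → ℤ_[p]) ⧸ L)] :
    MeasurableSet {M : Matrix (Fin n) (Fin (n + m)) ℤ_[p] | LinearMap.range M.mulVecLin = L} ∧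
    μ.real {M | LinearMap.range M.mulVecLin = L} =
      (Nat.card ((Fin n → ℤ_[p]) ⧸ L) : ℝ)⁻¹ ^ (n + m) * (etaF p (n + m) / etaF p m) := by
  have hrank : finrank ℤ_[p] L = n := by
    rw [finrank_eq_of_finite_quotient, finrank_fin_fun]
  have hfin : Finite ((Fin n → ℤ_[p]) ⧸ maximalIdeal ℤ_[p] • L) := by
    apply Nat.finite_of_card_ne_zero
    rw [card_quotient_maximalIdeal_smul]
    exact mul_ne_zero (pow_ne_zero _ Nat.card_pos.ne') Nat.card_pos.ne'
  let π := (maximalIdeal ℤ_[p] • L).mkQ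
  let φ : Matrix (Fin n) (Fin (n + m)) ℤ_[p] →+
      (Fin (n + m) → (Fin n → ℤ_[p]) ⧸ maximalIdeal ℤ_[p] • L) :=
    { toFun := fun M j => π (M.col j)
      map_zero' := funext fun _ => map_zero π
      map_add' := fun M M' => funext fun j => map_add π (M.col j) (M'.col j) }
  have hφ : Function.Surjective φ := fun t => by
    choose v hv using fun j => (maximalIdeal ℤ_[p] • L).mkQ_surjective (t j)
    exact ⟨Matrix.of fun i j => v j i, funext hv⟩
  have hset : {M : Matrix (Fin n) (Fin (n + m)) ℤ_[p] | LinearMap.range M.mulVecLin = L} =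
      φ ⁻¹' {t | Submodule.span ℤ_[p] (Set.range t) = L.map π} := by
    ext M
    rw [Set.mem_ofPred_eq, eq_iff_map_mkQ_maximalIdeal_smul_eq _ (IsNoetherian.noetherian L),
      Matrix.range_mulVecLin, Submodule.map_span, ← Set.range_comp]
    rfl
  have hm := fun x => (isOpen_preimage_singleton_of_finite φ x).measurableSet
  rw [hset]
  refine ⟨?_, ?_⟩
  · rw [← Set.biUnion_preimage_singleton]
    exact MeasurableSet.biUnion (Set.to_countable _) fun x _ => hm x
  · rw [measureReal_preimage_addMonoidHom μ φ hφ hm]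
    have := card_span_eq_map_mkQ L (k := n + m) (by omega)
    rw [hrank, PadicInt.card_residueField, Nat.add_sub_cancel_left] at this
    exact this

theorem measureReal_coker_linearEquiv {n m : ℕ}
    (μ : Measure (Matrix (Fin n) (Fin (n + m)) ℤ_[p])) [μ.IsAddLeftInvariant]
    [IsProbabilityMeasure μ] {G : Type*} [AddCommGroup G] [Module ℤ_[p] G] [Finite G] {r : ℕ}
    (hr : Nat.card (G ⧸ (maximalIdeal ℤ_[p] • ⊤ : Submodule ℤ_[p] G)) = p ^ r) (hrn : r ≤ n) :
    μ.real {M | Nonempty (((Fin n → ℤ_[p]) ⧸ LinearMap.range M.mulVecLin) ≃ₗ[ℤ_[p]] G)} =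
      (Nat.card G : ℝ)⁻¹ ^ m * (Nat.card (G ≃ₗ[ℤ_[p]] G) : ℝ)⁻¹
        * (etaF p (n + m) * etaF p n) / (etaF p m * etaF p (n - r)) := by
  have hp : (1 : ℝ) < p := by exact_mod_cast (Fact.out : p.Prime).one_lt
  have hη := fun k => etaF_pos hp k
  have hG : (Nat.card G : ℝ) ≠ 0 := Nat.cast_ne_zero.2 Nat.card_pos.ne'
  set 𝓛 : Set (Submodule ℤ_[p] (Fin n → ℤ_[p])) :=
    {L | Nonempty (((Fin n → ℤ_[p]) ⧸ L) ≃ₗ[ℤ_[p]] G)} with h𝓛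
  have hcount : (Nat.card 𝓛 : ℝ) * Nat.card (G ≃ₗ[ℤ_[p]] G) =
      (Nat.card G : ℝ) ^ n * (etaF p n / etaF p (n - r)) := by
    have h := card_span_eq_top_of_isLocalRing (R := ℤ_[p]) (G := G) (r := r) (k := n)
      (by rw [hr, PadicInt.card_residueField]) hrn
    rw [PadicInt.card_residueField, ← card_surjective_linearMap,
      ← card_submodule_mul_card_aut] at h
    exact_mod_cast h
  have hpos : (Nat.card 𝓛 : ℝ) * Nat.card (G ≃ₗ[ℤ_[p]] G) ≠ 0 := by
    rw [hcount]
    exact mul_ne_zero (pow_ne_zero _ hG) (div_pos (hη _) (hη _)).ne'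
  have hfin : 𝓛.Finite :=
    Nat.finite_of_card_ne_zero (Nat.cast_ne_zero.1 (left_ne_zero_of_mul hpos))
  have hmeas : ∀ L ∈ hfin.toFinset,
      MeasurableSet {M : Matrix (Fin n) (Fin (n + m)) ℤ_[p] | LinearMap.range M.mulVecLin = L} ∧
      μ.real {M | LinearMap.range M.mulVecLin = L} =
        (Nat.card G : ℝ)⁻¹ ^ (n + m) * (etaF p (n + m) / etaF p m) := fun L hL => by
    obtain ⟨e⟩ := hfin.mem_toFinset.1 hL
    have := Finite.of_equiv G e.symm.toEquiv
    rw [← Nat.card_congr e.toEquiv]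
    exact measureReal_range_mulVecLin_eq μ L
  have hset : {M : Matrix (Fin n) (Fin (n + m)) ℤ_[p] |
        Nonempty (((Fin n → ℤ_[p]) ⧸ LinearMap.range M.mulVecLin) ≃ₗ[ℤ_[p]] G)} =
      ⋃ L ∈ hfin.toFinset, {M | LinearMap.range M.mulVecLin = L} := by
    ext M
    simp [h𝓛]
  rw [hset, measureReal_biUnion_finset _ fun L hL => (hmeas L hL).1,
    Finset.sum_congr rfl fun L hL => (hmeas L hL).2, Finset.sum_const, nsmul_eq_mul,
    ← Nat.card_eq_card_finite_toFinset hfin, eq_div_of_mul_eq (right_ne_zero_of_mul hpos) hcount]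
  · have h1 := (hη m).ne'
    have h2 := (hη (n - r)).ne'
    rw [pow_add, inv_pow, inv_pow]
    field_simp
  · intro L _ L' _ h
    exact Set.disjoint_left.2 fun M hM hM' => h (hM.symm.trans hM')

end

/-- For a Haar probability measure `μ` on `Mat_{n×(n+m)}(ℤ_p)` and a finite
abelian `p`-group `G` with `r = dim_{F_p}(G/pG) ≤ n`,
`μ({M : coker M ≅ G}) = |G|^{−m}·|Aut(G)|^{−1}·η_{n+m}(p)·η_n(p)/(η_m(p)·η_{n−r}(p))`. -/
theorem stmt1 (p : ℕ) [Fact p.Prime] (m n : ℕ) (hn : 1 ≤ n)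
    (μ : Measure (Matrix (Fin n) (Fin (n + m)) ℤ_[p]))
    [μ.IsAddHaarMeasure] [IsProbabilityMeasure μ]
    (G : Type) [AddCommGroup G] [Fintype G]
    (hG : ∀ g : G, ∃ k : ℕ, p ^ k • g = 0)
    (r : ℕ) (hr : Nat.card (G ⧸ (p • AddMonoidHom.id G).range) = p ^ r)
    (hrn : r ≤ n) :
    (μ {M | Nonempty (((Fin n → ℤ_[p]) ⧸ LinearMap.range M.mulVecLin) ≃+ G)}).toReal
      = (Nat.card G : ℝ)⁻¹ ^ m * (Nat.card (G ≃+ G) : ℝ)⁻¹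
          * (etaF p (n + m) * etaF p n) / (etaF p m * etaF p (n - r)) := by
  obtain ⟨_⟩ := PadicInt.nonempty_module hG
  rw [← PadicInt.card_quotient_maximalIdeal_smul_top] at hr
  have h := measureReal_coker_linearEquiv μ hr hrn
  rw [← Nat.card_congr PadicInt.addEquivEquivLinearEquiv] at h
  rw [← h, Measure.real]
  congr 3
  ext M
  exact PadicInt.addEquivEquivLinearEquiv.nonempty_congr
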